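/- If an admissible move transforms an admissible cyclic word w_0 ∈ 𝔚⁺ into w_1 ∈ 𝔚⁺, then rk(w_1) ≤ rk(w_0); and if moreover m_{\{1,2\}}(w_1) ≠ m_{\{1,2\}}(w_0) (i.e. the relative cyclic order of labels 1 and 2 versus 1 and 2' changes), then rk(w_1) < rk(w_0). -/

import Mathlib

/-- Position of the (0-based) label `i % n` in the admissible cyclic word `w`. -/
def posOf (n : ℕ) (hn : 0 < n) (w : ZMod (2 * n) ≃ Fin n × Bool) (i : ℕ) :
    ZMod (2 * n) :=
  w.symm ((⟨i % n, Nat.mod_lt i hn⟩ : Fin n), false)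

/-- The counterclockwise distance (in positions, an element of `[0, 2n)`) from the
label `k` to the label `k+1`. -/
def arcδ (n : ℕ) (hn : 0 < n) (w : ZMod (2 * n) ≃ Fin n × Bool) (k : ℕ) : ℕ :=
  (posOf n hn w (k + 1) - posOf n hn w k).val

/-- Fold over the arcs `0, 1, …, k` between consecutive labels, producing `(s, c, T)`:
the number of maximal monotone runs so far, the accumulated content (complete
half-turns, `n` position-units each) of completed runs, and the length of the current
run. -/
def rkAux (n : ℕ) (dir : ℕ → Bool) (θ : ℕ → ℕ) : ℕ → ℕ × ℕ × ℕ
  | 0 => (1, 0, θ 0)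
  | k + 1 =>
    let r := rkAux n dir θ k
    if dir (k + 1) = dir k then (r.1, r.2.1, r.2.2 + θ (k + 1))
    else (r.1 + 1, r.2.1 + r.2.2 / n, θ (k + 1))

/-- The rank `rk(w) = 2·Cont(w) + s − 1` of an admissible cyclic word. -/
def rk (n : ℕ) (hn : 0 < n) (w : ZMod (2 * n) ≃ Fin n × Bool) : ℕ :=
  let dir : ℕ → Bool := fun k => decide (arcδ n hn w k < n)
  let θ : ℕ → ℕ := fun k => if arcδ n hn w k < n then arcδ n hn w k else 2 * n - arcδ n hn w k
  let r := rkAux n dir θ (n - 2)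
  2 * (r.2.1 + r.2.2 / n) + r.1 - 1

/-- An admissible move takes `w₀` to `w₁`: some label `a+1 ∈ {1,…,n-1}` (1-based: the
label `k-1` with `k = a+2`) together with its antipodal primed letter rotates one step
toward the label `a+2` (i.e. `k`) along the shorter of the two arcs joining them,
transposing with the adjacent letter `j` or `j'` (which is not `k` or `k'`), while the
primed letter transposes with the opposite adjacent letter. -/
def AdmissibleMove (n : ℕ) (w₀ w₁ : ZMod (2 * n) ≃ Fin n × Bool) : Prop :=
  ∃ (a : ℕ) (ha : a + 1 < n),
    let A : Fin n := ⟨a, by omega⟩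
    let B : Fin n := ⟨a + 1, ha⟩
    let p := w₀.symm (A, false)
    let tgt := w₀.symm (B, false)
    ∃ ccw : Bool,
      (ccw = true ↔ (tgt - p).val < n) ∧
      (let p' := if ccw then p + 1 else p - 1;
        w₀ p' ≠ (B, false) ∧ w₀ p' ≠ (B, true) ∧
        ∀ q : ZMod (2 * n), w₁ q =
          if q = p then w₀ p'
          else if q = p' then w₀ p
          else if q = p + (n : ZMod (2 * n)) then w₀ (p' + (n : ZMod (2 * n)))
          else if q = p' + (n : ZMod (2 * n)) then w₀ (p + (n : ZMod (2 * n)))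
          else w₀ q)

def stt (n : ℕ) (d : ℕ → ℤ) (k : ℕ) : ℕ × ℕ × ℕ :=
  rkAux n (fun k => decide (0 ≤ d k)) (fun k => (d k).natAbs) k

lemma stt_zero (n : ℕ) (d : ℕ → ℤ) : stt n d 0 = (1, 0, (d 0).natAbs) := rfl

lemma stt_same (n : ℕ) (d : ℕ → ℤ) (k : ℕ) (h : 0 ≤ d (k+1) ↔ 0 ≤ d k) :
    stt n d (k+1) = ((stt n d k).1, (stt n d k).2.1, (stt n d k).2.2 + (d (k+1)).natAbs) := by
  simp [stt, rkAux, h]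

lemma stt_diff (n : ℕ) (d : ℕ → ℤ) (k : ℕ) (h : ¬ (0 ≤ d (k+1) ↔ 0 ≤ d k)) :
    stt n d (k+1) = ((stt n d k).1 + 1, (stt n d k).2.1 + (stt n d k).2.2 / n,
      (d (k+1)).natAbs) := by
  simp only [stt, rkAux, decide_eq_decide, if_neg h]

def RelS (n : ℕ) (d0 d1 : ℕ → ℤ) (c k : ℕ) : Prop :=
  (0 ≤ d1 k ↔ 0 ≤ d0 k) ∧ ∀ u : ℕ,
    c + 2 * (stt n d1 k).2.1 + (stt n d1 k).1 + 2 * (((stt n d1 k).2.2 + u) / n) ≤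
      2 * (stt n d0 k).2.1 + (stt n d0 k).1 + 2 * (((stt n d0 k).2.2 + u) / n)

lemma RelS.step {n : ℕ} {d0 d1 : ℕ → ℤ} {c k : ℕ} (h : RelS n d0 d1 c k)
    (hd : d1 (k+1) = d0 (k+1)) : RelS n d0 d1 c (k+1) := by
  obtain ⟨h1, h2⟩ := h
  refine ⟨by rw [hd], fun u => ?_⟩
  by_cases hs : (0 ≤ d0 (k+1) ↔ 0 ≤ d0 k)
  · rw [stt_same n d0 k hs, stt_same n d1 k (by rw [hd, h1]; exact hs), hd]
    have := h2 ((d0 (k+1)).natAbs + u)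
    simpa only [add_assoc] using this
  · rw [stt_diff n d0 k hs, stt_diff n d1 k (by rw [hd, h1]; exact hs), hd]
    have := h2 0
    simp only [add_zero] at this ⊢
    omega

lemma RelS.prop {n : ℕ} {d0 d1 : ℕ → ℤ} {c k : ℕ} (h : RelS n d0 d1 c k) (m : ℕ)
    (hd : ∀ i, k < i → i ≤ k + m → d1 i = d0 i) : RelS n d0 d1 c (k+m) := by
  induction m with
  | zero => exact h
  | succ m ih =>
    exact (ih (fun i hi hi' => hd i hi (by omega))).step (hd _ (by omega) (by omega))

lemma stt_congr (n : ℕ) (d0 d1 : ℕ → ℤ) (k : ℕ) (h : ∀ i, i ≤ k → d1 i = d0 i) :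
    stt n d1 k = stt n d0 k := by
  induction k with
  | zero => simp [stt_zero, h]
  | succ k ih =>
    have ih' := ih (fun i hi => h i (by omega))
    have e1 := h k (by omega)
    have e2 := h (k+1) (by omega)
    by_cases hs : (0 ≤ d0 (k+1) ↔ 0 ≤ d0 k)
    · rw [stt_same n d0 k hs, stt_same n d1 k (by rw [e1, e2]; exact hs), ih', e2]
    · rw [stt_diff n d0 k hs, stt_diff n d1 k (by rw [e1, e2]; exact hs), ih', e2]

lemma stt_last (n : ℕ) (d0 d1 : ℕ → ℤ) (k : ℕ) (h : ∀ i, i < k → d1 i = d0 i)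
    (hk : 0 ≤ d1 k ↔ 0 ≤ d0 k) :
    (stt n d1 k).1 = (stt n d0 k).1 ∧ (stt n d1 k).2.1 = (stt n d0 k).2.1 ∧
    (stt n d1 k).2.2 + (d0 k).natAbs = (stt n d0 k).2.2 + (d1 k).natAbs := by
  cases k with
  | zero => simp [stt_zero]; omega
  | succ k =>
    have ih' := stt_congr n d0 d1 k (fun i hi => h i (by omega))
    have e1 := h k (by omega)
    by_cases hs : (0 ≤ d0 (k+1) ↔ 0 ≤ d0 k)
    · rw [stt_same n d0 k hs, stt_same n d1 k (by rw [e1, hk]; exact hs), ih']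
      refine ⟨rfl, rfl, ?_⟩
      simp only; omega
    · rw [stt_diff n d0 k hs, stt_diff n d1 k (by rw [e1, hk]; exact hs), ih']
      refine ⟨rfl, rfl, ?_⟩
      simp only; omega

lemma div_up (n x y : ℕ) (hn : 0 < n) : (x + y) / n ≤ x / n + y / n + 1 := by
  rw [Nat.add_div hn]; split_ifs <;> omega

lemma caseB0 (n : ℕ) (hn : 2 ≤ n) (d0 d1 : ℕ → ℤ) (ε : ℤ) (hε : ε = 1 ∨ ε = -1)
    (hs : 0 ≤ d0 1 ↔ ε = 1) (h1 : d1 1 = d0 1 - ε) (hs1 : 0 ≤ d1 1 ↔ 0 ≤ d0 1)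
    (hj : (d0 0 = -ε ∧ d1 0 = ε) ∨ (d0 0 = ε * (n - 1) ∧ d1 0 = - ε * (n-1))) :
    RelS n d0 d1 1 1 := by
  refine ⟨hs1, fun u => ?_⟩
  have a1 : 1 / n = 0 := Nat.div_eq_of_lt (by omega)
  have a2 : (n - 1) / n = 0 := Nat.div_eq_of_lt (by omega)
  rcases hj with ⟨e0, e1⟩ | ⟨e0, e1⟩
  · rw [stt_diff n d0 0 (by grind), stt_same n d1 0 (by grind), stt_zero, stt_zero]
    have b0 : (d0 0).natAbs = 1 := by omega
    have b1 : (d1 0).natAbs + (d1 1).natAbs = (d0 1).natAbs := by omega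
    simp only [zero_add, b1, b0, a1]
    omega
  · have c0 : 0 ≤ d0 0 ↔ ε = 1 := by rcases hε with rfl | rfl <;> grind
    have c1 : 0 ≤ d1 0 ↔ ε = -1 := by rcases hε with rfl | rfl <;> grind
    rw [stt_same n d0 0 (by grind), stt_diff n d1 0 (by grind), stt_zero, stt_zero]
    have b0 : (d1 0).natAbs = n - 1 := by rcases hε with rfl | rfl <;> grind
    have b1 : (d0 0).natAbs + (d0 1).natAbs + u = (d1 1).natAbs + u + n := by
      rcases hε with rfl | rfl <;> grind
    simp only [zero_add, b1, b0, a2]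
    rw [Nat.add_div_right _ (by omega)]
    omega

lemma caseB2 (n : ℕ) (hn : 2 ≤ n) (d0 d1 : ℕ → ℤ) (ε : ℤ) (hε : ε = 1 ∨ ε = -1) (b : ℕ)
    (hs : 0 ≤ d0 (b+2) ↔ ε = 1) (h1 : d1 (b+2) = d0 (b+2) - ε)
    (hs1 : 0 ≤ d1 (b+2) ↔ 0 ≤ d0 (b+2))
    (hj : (d0 (b+1) = -ε ∧ d1 (b+1) = ε) ∨ (d0 (b+1) = ε * (n - 1) ∧ d1 (b+1) = - ε * (n-1)))
    (hb : d1 b = d0 b - ε) (hsb : 0 ≤ d1 b ↔ 0 ≤ d0 b) (hlt : ∀ i, i < b → d1 i = d0 i) :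
    RelS n d0 d1 0 (b+2) := by
  refine ⟨hs1, fun u => ?_⟩
  have a1 : 1 / n = 0 := Nat.div_eq_of_lt (by omega)
  have a2 : (n - 1) / n = 0 := Nat.div_eq_of_lt (by omega)
  obtain ⟨l1, l2, l3⟩ := stt_last n d0 d1 b hlt hsb
  generalize hr0 : stt n d0 b = r0 at *
  generalize hr1 : stt n d1 b = r1 at *
  obtain ⟨s0, c0, T0⟩ := r0
  obtain ⟨s1, c1, T1⟩ := r1
  simp only at l1 l2 l3
  subst l1 l2
  rcases hj with ⟨e0, e1⟩ | ⟨e0, e1⟩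
  · by_cases hq : 0 ≤ d0 b ↔ ε = 1
    · rw [stt_diff n d0 (b+1) (by grind), stt_diff n d0 b (by grind), hr0,
        stt_same n d1 (b+1) (by grind), stt_same n d1 b (by grind), hr1,
        show b + 1 + 1 = b + 2 from rfl]
      have b0 : (d0 (b+1)).natAbs = 1 := by omega
      have b1 : T1 + (d1 (b+1)).natAbs + (d1 (b+2)).natAbs + u + 1 = T0 + ((d0 (b+2)).natAbs + u) := by
        omega
      have := div_up n T0 ((d0 (b+2)).natAbs + u) (by omega)
      rw [← b1] at this
      have h3 := Nat.div_le_div_right (c := n) (Nat.le_succ (T1 + (d1 (b+1)).natAbs + (d1 (b+2)).natAbs + u))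
      simp only [b0, a1] at *
      simp only [Nat.succ_eq_add_one] at h3
      omega
    · rw [stt_diff n d0 (b+1) (by grind), stt_same n d0 b (by grind), hr0,
        stt_same n d1 (b+1) (by grind), stt_diff n d1 b (by grind), hr1,
        show b + 1 + 1 = b + 2 from rfl]
      have b0 : T1 = T0 + (d0 (b+1)).natAbs := by omega
      have b1 : (d1 (b+1)).natAbs + (d1 (b+2)).natAbs = (d0 (b+2)).natAbs := by omega
      simp only [b0, b1]
      omega
  · have k0 : 0 ≤ d0 (b+1) ↔ ε = 1 := by rcases hε with rfl | rfl <;> grind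
    have k1 : 0 ≤ d1 (b+1) ↔ ε = -1 := by rcases hε with rfl | rfl <;> grind
    have m0 : (d0 (b+1)).natAbs = n - 1 := by rcases hε with rfl | rfl <;> grind
    have m1 : (d1 (b+1)).natAbs = n - 1 := by rcases hε with rfl | rfl <;> grind
    have m2 : (d0 (b+2)).natAbs = (d1 (b+2)).natAbs + 1 := by omega
    by_cases hq : 0 ≤ d0 b ↔ ε = 1
    · rw [stt_same n d0 (b+1) (by grind), stt_same n d0 b (by grind), hr0,
        stt_diff n d1 (b+1) (by grind), stt_diff n d1 b (by grind), hr1,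
        show b + 1 + 1 = b + 2 from rfl]
      have m3 : T0 = T1 + 1 := by omega
      have h3 := Nat.div_add_div_le_add_div (x := T1) (y := (d1 (b+2)).natAbs + u) (z := n)
      have h4 : T0 + (d0 (b+1)).natAbs + (d0 (b+2)).natAbs + u
          = (T1 + ((d1 (b+2)).natAbs + u)) + 1 + n := by omega
      have h5 := Nat.div_le_div_right (c := n) (Nat.le_succ (T1 + ((d1 (b+2)).natAbs + u)))
      simp only [Nat.succ_eq_add_one] at h5
      simp only [h4, m1, a2]
      rw [Nat.add_div_right _ (by omega)]
      omega
    · rw [stt_same n d0 (b+1) (by grind), stt_diff n d0 b (by grind), hr0,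
        stt_diff n d1 (b+1) (by grind), stt_same n d1 b (by grind), hr1,
        show b + 1 + 1 = b + 2 from rfl]
      have m3 : T1 + (d1 (b+1)).natAbs = T0 + n := by omega
      have h4 : (d0 (b+1)).natAbs + (d0 (b+2)).natAbs + u = (d1 (b+2)).natAbs + u + n := by omega
      simp only [m3, h4]
      rw [Nat.add_div_right _ (by omega), Nat.add_div_right _ (by omega)]
      omega

lemma floor_le (n T0 T1 : ℕ) (hn : 0 < n) (h1 : ¬ n ∣ T1) (h : T1 ≤ T0 + 1) :
    T1 / n ≤ T0 / n := by
  by_contra hc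
  push Not at hc
  have e0 := Nat.div_add_mod T0 n
  have e1 := Nat.div_add_mod T1 n
  have l0 := Nat.mod_lt T0 hn
  have l1 : T1 % n ≠ 0 := fun h => h1 (Nat.dvd_of_mod_eq_zero h)
  have : n * (T0 / n + 1) ≤ n * (T1 / n) := Nat.mul_le_mul_left _ hc
  rw [mul_add] at this
  omega

def sg (z : ℤ) : ℤ := if 0 ≤ z then 1 else -1

/-- Case A: no direction changes. -/
lemma caseA (n : ℕ) (hn : 2 ≤ n) (d0 d1 x0 x1 e : ℕ → ℤ) (ε : ℤ) (hε : ε = 1 ∨ ε = -1)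
    (a j : ℕ) (ha : a + 1 < n) (hja : j ≠ a)
    (he : ∀ i, e i = if i = a then ε else if i = j then -ε else 0)
    (hsa : 0 ≤ d0 a ↔ ε = 1)
    (hx0 : ∀ k, k + 1 < n → (n : ℤ) ∣ d0 k - (x0 (k+1) - x0 k))
    (hx1 : ∀ k, k + 1 < n → (n : ℤ) ∣ d1 k - (x1 (k+1) - x1 k))
    (hn1 : ∀ i l, i < n → l < n → i ≠ l → ¬ (n : ℤ) ∣ x1 i - x1 l)
    (hd : ∀ k, k + 1 < n → d1 k = d0 k + e (k+1) - e k)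
    (hs : ∀ k, k + 1 < n → (0 ≤ d1 k ↔ 0 ≤ d0 k)) :
    2 * ((stt n d1 (n-2)).2.1 + (stt n d1 (n-2)).2.2 / n) + (stt n d1 (n-2)).1 ≤
    2 * ((stt n d0 (n-2)).2.1 + (stt n d0 (n-2)).2.2 / n) + (stt n d0 (n-2)).1 := by
  have nat0 : ∀ z : ℤ, (z.natAbs : ℤ) = sg z * z := by
    intro z; unfold sg; split_ifs <;> omega
  have sgc : ∀ k, k + 1 < n → sg (d1 k) = sg (d0 k) := by
    intro k hk; simp only [sg, hs k hk]
  have sgv : ∀ z, sg z = 1 ∨ sg z = -1 := by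
    intro z; unfold sg; split_ifs <;> simp
  have sga : sg (d0 a) = ε := by
    unfold sg; split_ifs <;> grind
  have ndv : ∀ (T : ℕ) (z y : ℤ), (n : ℤ) ∣ T - sg z * y → ¬ (n : ℤ) ∣ y → ¬ n ∣ T := by
    intro T z y h1 h2 h3
    apply h2
    have h4 : (n : ℤ) ∣ T := by exact_mod_cast h3
    have h5 := (Int.dvd_iff_dvd_of_dvd_sub h1).1 h4
    rcases sgv z with h | h <;> rw [h] at h5 <;> simpa using h5
  have fl : ∀ k S, k + 1 < n → S ≤ k → (k + 1 ≠ a ∨ ¬ (0 ≤ d0 (k+1) ↔ 0 ≤ d0 k)) →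
      sg (d0 S) = sg (d0 k) → ∀ T0 T1 : ℕ, (T1 : ℤ) = T0 + sg (d0 k) * (e (k+1) - e S) →
      (n : ℤ) ∣ T0 - sg (d0 k) * (x0 (k+1) - x0 S) →
      (n : ℤ) ∣ T1 - sg (d0 k) * (x1 (k+1) - x1 S) → T1 / n ≤ T0 / n := by
    intro k S hk hS hend hsS T0 T1 hT q0 q1
    refine floor_le n T0 T1 (by omega)
      (ndv _ _ _ q1 (hn1 _ _ hk (by omega) (by omega))) ?_
    have hb : sg (d0 k) * (e (k+1) - e S) ≤ 1 := by
      by_cases c1 : S = a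
      · subst c1
        rw [← hsS, sga, he S, he (k+1), if_pos rfl, if_neg (by omega)]
        rcases hε with rfl | rfl <;> split_ifs <;> norm_num
      · by_cases c2 : k + 1 = a
        · have h3 : ¬ (0 ≤ d0 (k+1) ↔ 0 ≤ d0 k) := hend.resolve_left (by simpa using c2)
          have h4 : sg (d0 k) = - ε := by
            rw [← sga, ← c2]; unfold sg; split_ifs <;> grind
          rw [h4, he S, he (k+1), if_pos c2, if_neg c1]
          rcases hε with rfl | rfl <;> split_ifs <;> norm_num
        · rw [he S, he (k+1), if_neg c2, if_neg c1]
          rcases sgv (d0 k) with h | h <;> rw [h] <;> rcases hε with rfl | rfl <;> split_ifs <;>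
            first | omega | norm_num
    omega
  have main : ∀ k, k + 1 < n → (stt n d1 k).1 = (stt n d0 k).1 ∧
      (stt n d1 k).2.1 ≤ (stt n d0 k).2.1 ∧ ∃ S, S ≤ k ∧ sg (d0 S) = sg (d0 k) ∧
      ((stt n d1 k).2.2 : ℤ) = (stt n d0 k).2.2 + sg (d0 k) * (e (k+1) - e S) ∧
      (n : ℤ) ∣ (stt n d0 k).2.2 - sg (d0 k) * (x0 (k+1) - x0 S) ∧
      (n : ℤ) ∣ (stt n d1 k).2.2 - sg (d0 k) * (x1 (k+1) - x1 S) := by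
    intro k
    induction k with
    | zero =>
      intro hk
      refine ⟨rfl, le_rfl, 0, le_rfl, rfl, ?_, ?_, ?_⟩
      · simp only [stt_zero, nat0, sgc 0 hk]; rw [hd 0 hk]; ring
      · simp only [stt_zero, nat0, ← mul_sub]
        exact Dvd.dvd.mul_left (hx0 0 hk) _
      · simp only [stt_zero, nat0, sgc 0 hk, ← mul_sub]
        exact Dvd.dvd.mul_left (hx1 0 hk) _
    | succ k ih =>
      intro hk
      obtain ⟨i1, i2, S, hS, g1, g2, g3, g4⟩ := ih (by omega)
      have hsk := hs k (by omega)
      have hsk1 := hs (k+1) hk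
      by_cases hq : (0 ≤ d0 (k+1) ↔ 0 ≤ d0 k)
      · have hsg : sg (d0 (k+1)) = sg (d0 k) := by simp only [sg, hq]
        rw [stt_same n d0 k hq, stt_same n d1 k (by rw [hsk, hsk1]; exact hq)]
        refine ⟨i1, i2, S, by omega, by rw [hsg, g1], ?_, ?_, ?_⟩
        · simp only [Nat.cast_add]
          simp only [nat0, sgc (k+1) hk, g2, hsg]; rw [hd (k+1) hk]; ring
        · simp only [Nat.cast_add]
          have := dvd_add g3 (Dvd.dvd.mul_left (hx0 (k+1) hk) (sg (d0 k)))
          simp only [nat0, hsg]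
          obtain ⟨c, hc⟩ := this; exact ⟨c, by linear_combination hc⟩
        · simp only [Nat.cast_add]
          have := dvd_add g4 (Dvd.dvd.mul_left (hx1 (k+1) hk) (sg (d0 k)))
          simp only [nat0, sgc (k+1) hk, hsg]
          obtain ⟨c, hc⟩ := this; exact ⟨c, by linear_combination hc⟩
      · have hfl := fl k S (by omega) hS (Or.inr hq) g1 _ _ g2 g3 g4
        rw [stt_diff n d0 k hq, stt_diff n d1 k (by rw [hsk, hsk1]; exact hq)]
        refine ⟨by simp only [i1], by simp only; omega, k+1, le_rfl, rfl, ?_, ?_, ?_⟩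
        · simp only [nat0, sgc (k+1) hk]; rw [hd (k+1) hk]; ring
        · simp only [nat0, ← mul_sub]
          exact Dvd.dvd.mul_left (hx0 (k+1) hk) _
        · simp only [nat0, sgc (k+1) hk, ← mul_sub]
          exact Dvd.dvd.mul_left (hx1 (k+1) hk) _
  obtain ⟨i1, i2, S, hS, g1, g2, g3, g4⟩ := main (n-2) (by omega)
  have hfl := fl (n-2) S (by omega) hS (Or.inl (by omega)) g1 _ _ g2 g3 g4
  omega

def dd (n : ℕ) (hn : 0 < n) (w : ZMod (2 * n) ≃ Fin n × Bool) (k : ℕ) : ℤ :=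
  if arcδ n hn w k < n then (arcδ n hn w k : ℤ) else (arcδ n hn w k : ℤ) - 2 * n

lemma arc_lt (n : ℕ) (hn : 0 < n) (w : ZMod (2 * n) ≃ Fin n × Bool) (k : ℕ) :
    arcδ n hn w k < 2 * n := by
  haveI : NeZero (2 * n) := ⟨by omega⟩
  exact ZMod.val_lt _

lemma dd_nonneg (n : ℕ) (hn : 0 < n) (w : ZMod (2 * n) ≃ Fin n × Bool) (k : ℕ) :
    0 ≤ dd n hn w k ↔ arcδ n hn w k < n := by
  have := arc_lt n hn w k
  unfold dd; split_ifs <;> omega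

lemma rk_eq (n : ℕ) (hn : 0 < n) (w : ZMod (2 * n) ≃ Fin n × Bool) :
    rk n hn w = 2 * ((stt n (dd n hn w) (n-2)).2.1 + (stt n (dd n hn w) (n-2)).2.2 / n)
      + (stt n (dd n hn w) (n-2)).1 - 1 := by
  have h1 : (fun k => decide (0 ≤ dd n hn w k)) = fun k => decide (arcδ n hn w k < n) := by
    funext k; simp only [dd_nonneg]
  have h2 : (fun k => (dd n hn w k).natAbs) = fun k => if arcδ n hn w k < n then arcδ n hn w k else 2 * n - arcδ n hn w k := by
    funext k
    have := arc_lt n hn w k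
    unfold dd; split_ifs <;> omega
  unfold stt rk
  rw [h1, h2]

lemma stt_pos (n : ℕ) (d : ℕ → ℤ) (k : ℕ) : 1 ≤ (stt n d k).1 := by
  induction k with
  | zero => simp [stt_zero]
  | succ k ih =>
    by_cases hs : (0 ≤ d (k+1) ↔ 0 ≤ d k)
    · rw [stt_same n d k hs]; exact ih
    · rw [stt_diff n d k hs]; simp

def xx (n : ℕ) (hn : 0 < n) (w : ZMod (2 * n) ≃ Fin n × Bool) (k : ℕ) : ℤ :=
  ((posOf n hn w k).val : ℤ)

lemma xx_cast (n : ℕ) (hn : 0 < n) (w : ZMod (2 * n) ≃ Fin n × Bool) (k : ℕ) :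
    ((xx n hn w k : ℤ) : ZMod (2 * n)) = posOf n hn w k := by
  haveI : NeZero (2 * n) := ⟨by omega⟩
  simp [xx]

lemma dd_xx (n : ℕ) (hn : 0 < n) (w : ZMod (2 * n) ≃ Fin n × Bool) (k : ℕ) :
    (2 * n : ℤ) ∣ dd n hn w k - (xx n hn w (k+1) - xx n hn w k) := by
  haveI : NeZero (2 * n) := ⟨by omega⟩
  have h : (((2 * n : ℕ) : ℤ)) ∣ dd n hn w k - (xx n hn w (k+1) - xx n hn w k) := by
    rw [← ZMod.intCast_zmod_eq_zero_iff_dvd]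
    have h2 : ((2 : ZMod (2*n)) * (n : ZMod (2 * n))) = 0 := by
      exact_mod_cast ZMod.natCast_self (2 * n)
    push_cast
    rw [xx_cast, xx_cast]
    unfold dd
    split_ifs <;> push_cast <;> simp [arcδ, h2]
  exact_mod_cast h

lemma xx_inj (n : ℕ) (hn : 0 < n) (w : ZMod (2 * n) ≃ Fin n × Bool)
    (hadm : ∀ ℓ : Fin n, w.symm (ℓ, true) = w.symm (ℓ, false) + (n : ZMod (2 * n)))
    (i l : ℕ) (hi : i < n) (hl : l < n) (hil : i ≠ l) :
    ¬ (n : ℤ) ∣ xx n hn w i - xx n hn w l := by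
  rintro ⟨c, hc⟩
  have h2 : ((2 : ZMod (2*n)) * (n : ZMod (2 * n))) = 0 := by
    exact_mod_cast ZMod.natCast_self (2 * n)
  have h := congrArg (fun z : ℤ => (z : ZMod (2 * n))) hc
  simp only [Int.cast_sub, xx_cast, Int.cast_mul, Int.cast_natCast] at h
  have hne : (⟨i % n, Nat.mod_lt i hn⟩ : Fin n) ≠ ⟨l % n, Nat.mod_lt l hn⟩ := by
    simp [Nat.mod_eq_of_lt hi, Nat.mod_eq_of_lt hl, hil]
  rcases Int.even_or_odd' c with ⟨m, rfl | rfl⟩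
  · have : posOf n hn w i = posOf n hn w l := by
      push_cast at h
      linear_combination h + m * h2
    have := w.symm.injective this
    exact hne (congrArg Prod.fst this)
  · have : posOf n hn w i = w.symm (⟨l % n, Nat.mod_lt l hn⟩, true) := by
      rw [hadm]
      change _ = posOf n hn w l + _
      push_cast at h
      linear_combination h + m * h2
    have := w.symm.injective this
    exact hne (congrArg Prod.fst this)

lemma dd_bd (n : ℕ) (hn : 0 < n) (w : ZMod (2 * n) ≃ Fin n × Bool)
    (hadm : ∀ ℓ : Fin n, w.symm (ℓ, true) = w.symm (ℓ, false) + (n : ZMod (2 * n)))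
    (k : ℕ) (hk : k + 1 < n) :
    dd n hn w k ≠ 0 ∧ - (n : ℤ) < dd n hn w k ∧ dd n hn w k < n := by
  have h1 := xx_inj n hn w hadm (k+1) k hk (by omega) (by omega)
  have h2 := dd_xx n hn w k
  have h3 : (n : ℤ) ∣ dd n hn w k - (xx n hn w (k+1) - xx n hn w k) :=
    (Dvd.intro_left _ rfl).trans h2
  have h4 : ¬ (n : ℤ) ∣ dd n hn w k := fun h => h1 ((Int.dvd_iff_dvd_of_dvd_sub h3).1 h)
  have h5 := arc_lt n hn w k
  have h6 : dd n hn w k ≠ 0 := by intro h; rw [h] at h4; simp at h4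
  have h7 : dd n hn w k ≠ -n := by intro h; rw [h] at h4; simp at h4
  refine ⟨h6, ?_, ?_⟩ <;> unfold dd at * <;> split_ifs at * <;> omega

/-- Arithmetic core. -/
lemma core (n : ℕ) (hn : 2 ≤ n) (d0 d1 x0 x1 e : ℕ → ℤ) (ε : ℤ) (hε : ε = 1 ∨ ε = -1)
    (a j : ℕ) (ha : a + 1 < n) (hja : j ≠ a) (hja1 : j ≠ a + 1)
    (he : ∀ i, e i = if i = a then ε else if i = j then -ε else 0)
    (hsa : 0 ≤ d0 a ↔ ε = 1)
    (hx0 : ∀ k, k + 1 < n → (2 * n : ℤ) ∣ d0 k - (x0 (k+1) - x0 k))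
    (hx1 : ∀ k, k + 1 < n → (2 * n : ℤ) ∣ d1 k - (x1 (k+1) - x1 k))
    (hn1 : ∀ i l, i < n → l < n → i ≠ l → ¬ (n : ℤ) ∣ x1 i - x1 l)
    (hx : ∀ k, k < n → (2 * n : ℤ) ∣ x1 k - (x0 k + e k))
    (hj : (n : ℤ) ∣ x0 j - (x0 a + ε))
    (hb0 : ∀ k, k + 1 < n → d0 k ≠ 0 ∧ -(n : ℤ) < d0 k ∧ d0 k < n)
    (hb1 : ∀ k, k + 1 < n → d1 k ≠ 0 ∧ -(n : ℤ) < d1 k ∧ d1 k < n) :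
    (2 * ((stt n d1 (n-2)).2.1 + (stt n d1 (n-2)).2.2 / n) + (stt n d1 (n-2)).1 ≤
    2 * ((stt n d0 (n-2)).2.1 + (stt n d0 (n-2)).2.2 / n) + (stt n d0 (n-2)).1) ∧
    (¬ (0 ≤ d1 0 ↔ 0 ≤ d0 0) →
    2 * ((stt n d1 (n-2)).2.1 + (stt n d1 (n-2)).2.2 / n) + (stt n d1 (n-2)).1 <
    2 * ((stt n d0 (n-2)).2.1 + (stt n d0 (n-2)).2.2 / n) + (stt n d0 (n-2)).1) := by
  have hdm : ∀ k, k + 1 < n → (2 * n : ℤ) ∣ d1 k - (d0 k + e (k+1) - e k) := by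
    intro k hk
    have := dvd_add (dvd_sub (hx1 k hk) (hx0 k hk))
      (dvd_sub (hx (k+1) hk) (hx k (by omega)))
    obtain ⟨c, hc⟩ := this; exact ⟨c, by linear_combination hc⟩
  have hd : ∀ k, k + 1 < n → ¬ (k + 1 = a ∧ k = j) →
      d1 k = d0 k + e (k+1) - e k ∧ (0 ≤ d1 k ↔ 0 ≤ d0 k) := by
    intro k hk hne
    obtain ⟨c, hc⟩ := hdm k hk
    have hb : -1 ≤ e (k+1) - e k ∧ e (k+1) - e k ≤ 1 := by
      rw [he, he]; split_ifs <;> omega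
    have b0 := hb0 k hk
    have b1 := hb1 k hk
    have hc0 : c = 0 := by
      have h1 : (n : ℤ) * c < n * 1 := by nlinarith
      have h2 : (n : ℤ) * (-1) < n * c := by nlinarith
      have hnp : (0 : ℤ) < n := by omega
      have h3 := lt_of_mul_lt_mul_left h1 hnp.le
      have h4 := lt_of_mul_lt_mul_left h2 hnp.le
      omega
    subst hc0
    omega
  by_cases hc : j + 1 = a
  · subst hc
    have hval : (d0 j = -ε ∧ d1 j = ε) ∨ (d0 j = ε * (n - 1) ∧ d1 j = - ε * (n-1)) := by
      have b0 := hb0 j (by omega)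
      have b1 := hb1 j (by omega)
      obtain ⟨c, hc⟩ := hdm j (by omega)
      have h3 : (n : ℤ) ∣ d0 j - (x0 (j+1) - x0 j) :=
        (Dvd.intro_left _ rfl).trans (hx0 j (by omega))
      obtain ⟨m, hm⟩ := dvd_sub h3 hj
      have hm' : d0 j + ε = n * m := by linarith
      have e1 : e (j+1) = ε := by rw [he]; simp
      have e2 : e j = -ε := by rw [he]; simp
      rw [e1, e2] at hc
      have hnp : (0 : ℤ) < n := by omega
      have h1 : m < 2 := by
        refine lt_of_mul_lt_mul_left (a := (n:ℤ)) ?_ hnp.le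
        rcases hε with rfl | rfl <;> nlinarith
      have h2 : -2 < m := by
        refine lt_of_mul_lt_mul_left (a := (n:ℤ)) ?_ hnp.le
        rcases hε with rfl | rfl <;> nlinarith
      have h5 : c < 2 := by
        refine lt_of_mul_lt_mul_left (a := (n:ℤ)) ?_ hnp.le
        rcases hε with rfl | rfl <;> nlinarith
      have h6 : -2 < c := by
        refine lt_of_mul_lt_mul_left (a := (n:ℤ)) ?_ hnp.le
        rcases hε with rfl | rfl <;> nlinarith
      rcases hε with rfl | rfl <;> interval_cases m <;> interval_cases c <;> omega
    have hrest : ∀ k, j + 1 < k → k + 1 < n → d1 k = d0 k := by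
      intro k hk hk'
      have := (hd k hk' (by omega)).1
      rw [he, he] at this
      rw [this]; split_ifs <;> omega
    have hA := hd (j+1) ha (by omega)
    have hA1 : d1 (j+1) = d0 (j+1) - ε := by
      rw [hA.1, he, he]; split_ifs <;> omega
    have fin : ∀ c, RelS n d0 d1 c (j+1) → c +
        (2 * ((stt n d1 (n-2)).2.1 + (stt n d1 (n-2)).2.2 / n) + (stt n d1 (n-2)).1) ≤
        2 * ((stt n d0 (n-2)).2.1 + (stt n d0 (n-2)).2.2 / n) + (stt n d0 (n-2)).1 := by
      intro c hR
      have := (hR.prop (n - 2 - (j+1)) (fun i hi hi' => hrest i hi (by omega))).2 0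
      rw [show j + 1 + (n - 2 - (j+1)) = n - 2 by omega] at this
      simp only [add_zero] at this
      omega
    rcases j with _ | b
    · have := fin 1 (caseB0 n hn d0 d1 ε hε hsa hA1 hA.2 hval)
      exact ⟨by omega, fun _ => by omega⟩
    · have hB := hd b (by omega) (by omega)
      have hB1 : d1 b = d0 b - ε := by
        rw [hB.1, he, he]; split_ifs <;> omega
      have hlt : ∀ i, i < b → d1 i = d0 i := by
        intro k hk
        have := (hd k (by omega) (by omega)).1
        rw [he, he] at this
        rw [this]; split_ifs <;> omega
      have := fin 0 (caseB2 n hn d0 d1 ε hε b hsa hA1 hA.2 hval hB1 hB.2 hlt)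
      refine ⟨by omega, fun h => absurd ?_ h⟩
      exact (hd 0 (by omega) (by omega)).2
  · have hdv : (n : ℤ) ∣ 2 * n := Dvd.intro_left _ rfl
    refine ⟨caseA n hn d0 d1 x0 x1 e ε hε a j ha hja he hsa
      (fun k hk => hdv.trans (hx0 k hk)) (fun k hk => hdv.trans (hx1 k hk)) hn1
      (fun k hk => (hd k hk (by omega)).1) (fun k hk => (hd k hk (by omega)).2), fun h => absurd ?_ h⟩
    exact (hd 0 (by omega) (by omega)).2

/-- an admissible move never increases the rank, and it strictly
decreases the rank whenever it changes the sign of `m_{{1,2}}` (the relative cyclic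
order of the labels `1` and `2` versus `1` and `2'`). -/
theorem rank_monotone_under_move (n : ℕ) (hn : 2 ≤ n)
    (w₀ w₁ : ZMod (2 * n) ≃ Fin n × Bool)
    (hadm₀ : ∀ ℓ : Fin n, w₀.symm (ℓ, true) = w₀.symm (ℓ, false) + (n : ZMod (2 * n)))
    (hadm₁ : ∀ ℓ : Fin n, w₁.symm (ℓ, true) = w₁.symm (ℓ, false) + (n : ZMod (2 * n)))
    (hW₀ : arcδ n (by omega) w₀ (n - 2) < n)
    (hW₁ : arcδ n (by omega) w₁ (n - 2) < n)
    (hmove : AdmissibleMove n w₀ w₁) :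
    rk n (by omega) w₁ ≤ rk n (by omega) w₀ ∧
    (((arcδ n (by omega) w₁ 0 < n) ≠ (arcδ n (by omega) w₀ 0 < n)) →
      rk n (by omega) w₁ < rk n (by omega) w₀) := by
  have hn0 : 0 < n := by omega
  haveI : NeZero (2 * n) := ⟨by omega⟩
  haveI : Fact (1 < 2 * n) := ⟨by omega⟩
  have h2 : ((2 : ZMod (2*n)) * (n : ZMod (2 * n))) = 0 := by
    exact_mod_cast ZMod.natCast_self (2 * n)
  obtain ⟨a, ha, ccw, hccw, hB0, hB1, hw⟩ := hmove
  have hpa : w₀.symm (⟨a, by omega⟩, false) = posOf n hn0 w₀ a := by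
    simp [posOf, Nat.mod_eq_of_lt (show a < n by omega)]
  have hpb : w₀.symm (⟨a + 1, ha⟩, false) = posOf n hn0 w₀ (a + 1) := by
    simp [posOf, Nat.mod_eq_of_lt ha]
  obtain ⟨ε, hεd⟩ : ∃ ε : ℤ, ε = if ccw then 1 else -1 := ⟨_, rfl⟩
  have hε : ε = 1 ∨ ε = -1 := by rw [hεd]; split_ifs <;> simp
  have hp' : (if ccw then w₀.symm (⟨a, by omega⟩, false) + 1
      else w₀.symm (⟨a, by omega⟩, false) - 1) = posOf n hn0 w₀ a + (ε : ZMod (2 * n)) := by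
    rw [hpa, hεd]; split_ifs <;> simp [sub_eq_add_neg]
  rw [hp'] at hB0 hB1
  simp only [hp'] at hw
  rw [hpa] at hw
  rw [hpb, hpa] at hccw
  set p := posOf n hn0 w₀ a with hp
  have hwp : w₀ p = (⟨a, by omega⟩, false) := by rw [← hpa]; simp
  obtain ⟨jj, b, hjb⟩ : ∃ jj b, w₀ (p + (ε : ZMod (2 * n))) = (jj, b) := ⟨_, _, rfl⟩
  have hjs : w₀.symm (jj, b) = p + (ε : ZMod (2 * n)) := by rw [← hjb]; simp
  have hε0 : (ε : ZMod (2 * n)) ≠ 0 := by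
    rcases hε with h | h <;> rw [h] <;> simp
  have hjs1 : w₁.symm (jj, b) = p := by
    rw [Equiv.symm_apply_eq, hw p, if_pos rfl, hjb]
  have has1 : w₁.symm (⟨a, by omega⟩, false) = p + (ε : ZMod (2 * n)) := by
    rw [Equiv.symm_apply_eq, hw, if_neg (by simpa using hε0), if_pos rfl, hwp]
  have hjs01 : w₁.symm (jj, false) = w₀.symm (jj, false) - (ε : ZMod (2 * n)) := by
    cases b with
    | false => rw [hjs, hjs1]; ring
    | true =>
      rw [hadm₀] at hjs
      rw [hadm₁] at hjs1
      linear_combination hjs1 - hjs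
  have hja : jj.1 ≠ a := by
    intro h
    have hjj : jj = ⟨a, by omega⟩ := Fin.ext h
    have hεn : (ε : ZMod (2 * n)) = 0 ∨ (ε : ZMod (2 * n)) = n := by
      rw [hjj] at hjs
      cases b with
      | false => left; rw [hpa] at hjs; linear_combination -hjs
      | true => right; rw [hadm₀, hpa] at hjs; linear_combination -hjs
    have hdiv : (n : ℤ) ∣ ε := by
      have h3 : ((2 * n : ℕ) : ℤ) ∣ ε ∨ ((2 * n : ℕ) : ℤ) ∣ ε - n := by
        rcases hεn with h | h
        · left; rwa [← ZMod.intCast_zmod_eq_zero_iff_dvd]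
        · right; rw [← ZMod.intCast_zmod_eq_zero_iff_dvd]; push_cast; rw [h]; ring
      rcases h3 with ⟨c, hc⟩ | ⟨c, hc⟩
      · exact ⟨2 * c, by rw [hc]; push_cast; ring⟩
      · exact ⟨2 * c + 1, by push_cast at hc; linear_combination hc⟩
    have hu : (n : ℤ) ∣ 1 := by
      rcases hε with h | h <;> rw [h] at hdiv
      · exact hdiv
      · simpa using hdiv
    have := Int.le_of_dvd one_pos hu
    omega
  have hja1 : jj.1 ≠ a + 1 := by
    intro h
    have hjj : jj = ⟨a + 1, ha⟩ := Fin.ext h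
    rw [hjb, hjj] at hB0 hB1
    cases b <;> simp at hB0 hB1
  have hother : ∀ l : Fin n, l.1 ≠ a → l ≠ jj → w₁.symm (l, false) = w₀.symm (l, false) := by
    intro l hl1 hl2
    have key : ∀ q, w₀ q = (l, false) → q ≠ p ∧ q ≠ p + (ε : ZMod (2 * n)) ∧
        q ≠ p + (n : ZMod (2 * n)) ∧ q ≠ p + (ε : ZMod (2 * n)) + (n : ZMod (2 * n)) := by
      intro q hq
      refine ⟨?_, ?_, ?_, ?_⟩
      · rintro rfl; rw [hwp] at hq
        exact hl1 (congrArg (fun z : Fin n × Bool => z.1.1) hq).symm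
      · rintro rfl; rw [hjb] at hq
        exact hl2 (congrArg Prod.fst hq).symm
      · rintro rfl
        rw [← hpa, ← hadm₀] at hq
        simp only [Equiv.apply_symm_apply, Prod.mk.injEq] at hq
        simp at hq
      · rintro rfl
        have h5 : p + (ε : ZMod (2 * n)) + (n : ZMod (2 * n)) = w₀.symm (jj, !b) := by
          rw [← hjs]
          cases b with
          | false => simp [hadm₀]
          | true => rw [hadm₀]; simp only [Bool.not_true]; linear_combination h2
        rw [h5] at hq
        simp only [Equiv.apply_symm_apply, Prod.mk.injEq] at hq
        exact hl2 hq.1.symm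
    obtain ⟨k1, k2, k3, k4⟩ := key (w₀.symm (l, false)) (by simp)
    rw [Equiv.symm_apply_eq, hw, if_neg k1, if_neg k2, if_neg k3, if_neg k4]
    simp
  have hpos : ∀ k, k < n → posOf n hn0 w₁ k = posOf n hn0 w₀ k +
      (((if k = a then ε else if k = jj.1 then -ε else 0 : ℤ)) : ZMod (2 * n)) := by
    intro k hk
    unfold posOf
    simp only [Nat.mod_eq_of_lt hk]
    by_cases c1 : k = a
    · subst c1
      rw [if_pos rfl, has1, hpa]
    · rw [if_neg c1]
      by_cases c2 : k = jj.1
      · subst c2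
        rw [if_pos rfl]
        simp only [Fin.eta]
        rw [hjs01]; push_cast; ring
      · rw [if_neg c2, hother ⟨k, hk⟩ c1 (fun h => c2 (by rw [← h]))]
        simp
  have hres := core n hn (dd n hn0 w₀) (dd n hn0 w₁) (xx n hn0 w₀) (xx n hn0 w₁)
    (fun k => if k = a then ε else if k = jj.1 then -ε else 0) ε hε a jj.1 ha hja hja1
    (fun i => rfl)
    (by
      rw [dd_nonneg, arcδ, ← hp, ← hccw, hεd]
      cases ccw <;> simp)
    (fun k _ => dd_xx n hn0 w₀ k) (fun k _ => dd_xx n hn0 w₁ k)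
    (xx_inj n hn0 w₁ hadm₁)
    (by
      intro k hk
      have : ((2 * n : ℕ) : ℤ) ∣ xx n hn0 w₁ k - (xx n hn0 w₀ k +
          (if k = a then ε else if k = jj.1 then -ε else 0)) := by
        rw [← ZMod.intCast_zmod_eq_zero_iff_dvd, Int.cast_sub, Int.cast_add, xx_cast, xx_cast,
          hpos k hk, sub_self]
      exact_mod_cast this)
    (by
      have hj0 : posOf n hn0 w₀ jj.1 = w₀.symm (jj, false) := by
        simp [posOf, Nat.mod_eq_of_lt jj.2]
      have h3 : ((2 * n : ℕ) : ℤ) ∣ xx n hn0 w₀ jj.1 - (xx n hn0 w₀ a + ε) ∨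
          ((2 * n : ℕ) : ℤ) ∣ xx n hn0 w₀ jj.1 - (xx n hn0 w₀ a + ε) + n := by
        rw [← ZMod.intCast_zmod_eq_zero_iff_dvd, ← ZMod.intCast_zmod_eq_zero_iff_dvd]
        push_cast
        rw [xx_cast, xx_cast, hj0, ← hp]
        cases b with
        | false => left; rw [hjs]; ring
        | true => right; rw [hadm₀] at hjs; linear_combination hjs
      rcases h3 with ⟨c, hc⟩ | ⟨c, hc⟩
      · exact ⟨2 * c, by rw [hc]; push_cast; ring⟩
      · exact ⟨2 * c - 1, by push_cast at hc; linear_combination hc⟩)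
    (dd_bd n hn0 w₀ hadm₀) (dd_bd n hn0 w₁ hadm₁)
  have q0 := stt_pos n (dd n hn0 w₀) (n-2)
  have q1 := stt_pos n (dd n hn0 w₁) (n-2)
  rw [rk_eq, rk_eq]
  refine ⟨by omega, fun h => ?_⟩
  have := hres.2 (by
    rw [dd_nonneg, dd_nonneg]
    exact fun hh => h (propext hh))
  omega
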